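/- Let π ∈ M_{2n} have exactly C(2n−1,2) − c valid pointer contexts with c > 0. Then c ∉ {1, 2, 3}; that is, no element of M_{2n} has exactly C(2n−1,2)−1, C(2n−1,2)−2, or C(2n−1,2)−3 valid pointer contexts. -/

import Mathlib

/-- The representative of `x : ZMod n` in `{1, …, n}` (so `0` represents `n`). -/
def repr1 (n : ℕ) (x : ZMod n) : ℕ := if x = 0 then n else x.val

/-- Values of `ZMod n`, embedded into `ZMod (n+1)` via representatives in `{1, …, n}`. -/
def emb (n : ℕ) (x : ZMod n) : ZMod (n + 1) := (repr1 n x : ZMod (n + 1))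

/-- `L 0 = 0` and `L i = π(i)` for `i ∈ {1,…,n}`: the listing used to build
the cycle `Y_π = (π(n) π(n−1) … π(1) 0)`. -/
def listFun (n : ℕ) (π : Equiv.Perm (ZMod n)) : ZMod (n + 1) → ZMod (n + 1) :=
  fun i => if i = 0 then 0 else emb n (π (i.val : ZMod n))

/-- The inverse listing of `listFun`. -/
def listInv (n : ℕ) (π : Equiv.Perm (ZMod n)) : ZMod (n + 1) → ZMod (n + 1) :=
  fun y => if y = 0 then 0 else emb n (π.symm (y.val : ZMod n))

/-- The cycle `Y_π = (π(n) π(n−1) … π(1) 0)` on `{0,1,…,n}`, as a function: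
it sends `L(i)` to `L(i-1)`. -/
def Yfun (n : ℕ) (π : Equiv.Perm (ZMod n)) : ZMod (n + 1) → ZMod (n + 1) :=
  fun y => listFun n π (listInv n π y - 1)

/-- `C_π = Y_π ∘ X_n`, where `X_n` is the cycle `(0 1 2 … n)`, i.e. `x ↦ x + 1`. -/
def Cfun (n : ℕ) (π : Equiv.Perm (ZMod n)) : ZMod (n + 1) → ZMod (n + 1) :=
  fun x => Yfun n π (x + 1)

/-- The strategic pile of `π ∈ S_n`: the set of values appearing strictly after `n` and
strictly before `0` on the cycle of `C_π` containing `0` and `n` (empty if `0` and `n`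
lie in different cycles). -/
def strategicPile (n : ℕ) (π : Equiv.Perm (ZMod n)) : Set (ZMod (n + 1)) :=
  {x | ∃ k m : ℕ, 0 < k ∧ k < m ∧ (Cfun n π)^[m] (n : ZMod (n + 1)) = 0 ∧
      (∀ j, 0 < j → j < m → (Cfun n π)^[j] (n : ZMod (n + 1)) ≠ 0) ∧
      (Cfun n π)^[k] (n : ZMod (n + 1)) = x}

/-- `π ∈ S_n` has maximal strategic pile. -/
def MaxPile (n : ℕ) (π : Equiv.Perm (ZMod n)) : Prop :=
  (Even n ∧ (strategicPile n π).ncard = n - 1) ∨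
  (Odd n ∧ (strategicPile n π).ncard = n - 2)

/-- The position (in `{1,…,n}`) of the value `v` in `π`. -/
def idx (n : ℕ) (π : Equiv.Perm (ZMod n)) (v : ZMod n) : ℕ := repr1 n (π.symm v)

/-- Word coordinate of the occurrence of the pointer `(p,p+1)` as the right pointer of the
entry `p`:  the entry at position `i` is given word coordinate `3*i - 1`, its left pointer
coordinate `3*i - 2` and its right pointer coordinate `3*i`. -/
def posR (n : ℕ) (π : Equiv.Perm (ZMod n)) (p : ZMod n) : ℕ := 3 * idx n π p

/-- Word coordinate of the occurrence of the pointer `(p,p+1)` as the left pointer of the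
entry `p+1`. -/
def posL (n : ℕ) (π : Equiv.Perm (ZMod n)) (p : ZMod n) : ℕ := 3 * idx n π (p + 1) - 2

/-- Two pairs of positions interleave (pattern `a b a b` or `b a b a`). -/
def Interleaved (a1 a2 b1 b2 : ℕ) : Prop :=
  (min a1 a2 < min b1 b2 ∧ min b1 b2 < max a1 a2 ∧ max a1 a2 < max b1 b2) ∨
  (min b1 b2 < min a1 a2 ∧ min a1 a2 < max b1 b2 ∧ max b1 b2 < max a1 a2)

/-- `(p, q)` is a valid pointer context for `π`: the two pointers are distinct and their
occurrences in the pointer word of `π` appear in the order `p,q,p,q` or `q,p,q,p`. -/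
def ValidContext (n : ℕ) (π : Equiv.Perm (ZMod n)) (p q : ZMod n) : Prop :=
  p ≠ q ∧ Interleaved (posR n π p) (posL n π p) (posR n π q) (posL n π q)

/-- The number of (unordered) valid pointer contexts of `π`. -/
noncomputable def numContexts (n : ℕ) (π : Equiv.Perm (ZMod n)) : ℕ :=
  {pq : ZMod n × ZMod n | ValidContext n π pq.1 pq.2}.ncard / 2

/-- `ρ ∈ S_{2n−1}` is the contraction of `π ∈ S_{2n}`, obtained by deleting the entry `2n`. -/
def IsContraction (n : ℕ) (ρ : Equiv.Perm (ZMod (2 * n - 1)))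
    (π : Equiv.Perm (ZMod (2 * n))) : Prop :=
  ∃ m : ℕ, 1 ≤ m ∧ m ≤ 2 * n ∧ π (m : ZMod (2 * n)) = ((2 * n : ℕ) : ZMod (2 * n)) ∧
    (∀ k : ℕ, 1 ≤ k → k < m →
      ρ (k : ZMod (2 * n - 1)) =
        ((repr1 (2 * n) (π (k : ZMod (2 * n))) : ℕ) : ZMod (2 * n - 1))) ∧
    (∀ k : ℕ, m ≤ k → k ≤ 2 * n - 1 →
      ρ (k : ZMod (2 * n - 1)) =
        ((repr1 (2 * n) (π ((k + 1 : ℕ) : ZMod (2 * n))) : ℕ) : ZMod (2 * n - 1)))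

/-- `M_{2n}`: the contractions of permutations in `S_{2n}` with maximal strategic pile. -/
def MsetAll (n : ℕ) : Set (Equiv.Perm (ZMod (2 * n - 1))) :=
  {ρ | ∃ π : Equiv.Perm (ZMod (2 * n)), MaxPile (2 * n) π ∧ IsContraction n ρ π}

/-- `M_{2n,k}`: the contractions of permutations in `S_{2n}` with maximal strategic pile
and exactly `k` valid pointer contexts. -/
def Mset (n k : ℕ) : Set (Equiv.Perm (ZMod (2 * n - 1))) :=
  {ρ | ρ ∈ MsetAll n ∧ numContexts (2 * n - 1) ρ = k}

/-- Cyclic shift by `a`: `C_a(π)(x) = π(x - a)`. -/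
def Cshift (n : ℕ) (a : ZMod n) (π : Equiv.Perm (ZMod n)) : Equiv.Perm (ZMod n) :=
  (Equiv.subRight a).trans π

/-- Translation by `b`: `T_b(π)(x) = π(x) + b`. -/
def Tshift (n : ℕ) (b : ZMod n) (π : Equiv.Perm (ZMod n)) : Equiv.Perm (ZMod n) :=
  π.trans (Equiv.addRight b)

/-- `φ(a,b,π) = C_a(T_b(π))`, i.e. `x ↦ π(x-a) + b`. -/
def phiAct (n : ℕ) (a b : ZMod n) (π : Equiv.Perm (ZMod n)) : Equiv.Perm (ZMod n) :=
  Cshift n a (Tshift n b π)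

/-- The difference sequence of `π`. -/
def Dseq (n : ℕ) (π : Equiv.Perm (ZMod n)) : ZMod n → ZMod n :=
  fun k => π (k + 1) - π k

/-- The difference sequence of `π` is periodic with (least) period `p`, `0 < p < n`. -/
def PeriodicWith (n : ℕ) (π : Equiv.Perm (ZMod n)) (p : ℕ) : Prop :=
  0 < p ∧ p < n ∧ (∀ k : ZMod n, Dseq n π (k + (p : ZMod n)) = Dseq n π k) ∧
    ∀ q : ℕ, 0 < q → q < p → ¬ ∀ k : ZMod n, Dseq n π (k + (q : ZMod n)) = Dseq n π k


section Chords

variable {N : ℕ} [NeZero N] (π : Equiv.Perm (ZMod N))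

theorem repr1_pos (x : ZMod N) : 1 ≤ repr1 N x := by
  have := NeZero.pos N
  unfold repr1
  split_ifs with h
  · exact this
  · have := (ZMod.val_ne_zero x).2 h
    omega

theorem repr1_le (x : ZMod N) : repr1 N x ≤ N := by
  unfold repr1
  split_ifs
  · rfl
  · exact (ZMod.val_lt x).le

@[simp] theorem repr1_cast (x : ZMod N) : ((repr1 N x : ℕ) : ZMod N) = x := by
  unfold repr1
  split_ifs with h
  · simp [h]
  · simp

theorem repr1_injective : Function.Injective (repr1 N) :=
  Function.LeftInverse.injective (g := fun k : ℕ => (k : ZMod N)) repr1_cast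

theorem repr1_natCast {k : ℕ} (h1 : 1 ≤ k) (h2 : k ≤ N) : repr1 N (k : ZMod N) = k := by
  have h := repr1_cast (k : ZMod N)
  have l1 := repr1_pos (k : ZMod N)
  have l2 := repr1_le (k : ZMod N)
  rw [ZMod.natCast_eq_natCast_iff] at h
  have h' : repr1 N (k : ZMod N) - 1 ≡ k - 1 [MOD N] := by
    apply Nat.ModEq.add_right_cancel' 1
    rwa [Nat.sub_add_cancel l1, Nat.sub_add_cancel h1]
  have := Nat.ModEq.eq_of_lt_of_lt h' (by omega) (by omega)
  omega

theorem idx_injective : Function.Injective (idx N π) :=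
  repr1_injective.comp π.symm.injective

/-- Parity of the number of endpoints of the chords in `S` with word coordinate below `t`. -/
def endpointParity (S : Finset (ZMod N)) (t : ℕ) : ZMod 2 :=
  ∑ s ∈ S, ((if posR N π s < t then 1 else 0) + (if posL N π s < t then 1 else 0))

open Classical in
/-- Parity of the number of chords of `S` crossing the chord `c`. -/
noncomputable def crossParity (S : Finset (ZMod N)) (c : ZMod N) : ZMod 2 :=
  ∑ s ∈ S, if ValidContext N π s c then 1 else 0

theorem indicator_sum_of_ne {a b c d : ℕ} (hac : a ≠ c) (had : a ≠ d) (hbc : b ≠ c)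
    (hbd : b ≠ d) [Decidable (Interleaved a b c d)] :
    ((if a < c then 1 else 0) + (if b < c then 1 else 0) +
      ((if a < d then 1 else 0) + (if b < d then 1 else 0)) : ZMod 2) =
      if Interleaved a b c d then 1 else 0 := by
  by_cases h : Interleaved a b c d
  · rw [if_pos h]
    unfold Interleaved at h
    split_ifs <;> first | decide | (exfalso; omega)
  · rw [if_neg h]
    unfold Interleaved at h
    split_ifs <;> first | decide | (exfalso; omega)

theorem endpointParity_posR_add_posL (S : Finset (ZMod N)) (c : ZMod N) :
    endpointParity π S (posR N π c) + endpointParity π S (posL N π c) =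
      crossParity π S c + if c ∈ S then 1 else 0 := by
  classical
  unfold endpointParity crossParity
  rw [← Finset.sum_ite_eq' S c (fun _ => (1 : ZMod 2)), ← Finset.sum_add_distrib,
    ← Finset.sum_add_distrib]
  refine Finset.sum_congr rfl fun s _ => ?_
  have rs : posR N π s = 3 * idx N π s := rfl
  have ls : posL N π s = 3 * idx N π (s + 1) - 2 := rfl
  have rc : posR N π c = 3 * idx N π c := rfl
  have lc : posL N π c = 3 * idx N π (c + 1) - 2 := rfl
  have p1 : 1 ≤ idx N π (c + 1) := repr1_pos _
  have p2 : 1 ≤ idx N π (s + 1) := repr1_pos _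
  by_cases h : s = c
  · subst h
    simp only [ValidContext, ne_eq, not_true_eq_false, false_and, if_false, if_true]
    split_ifs <;> first | decide | (exfalso; omega)
  · have h1 : idx N π s ≠ idx N π c := fun e => h (idx_injective π e)
    have h2 : idx N π (s + 1) ≠ idx N π (c + 1) :=
      fun e => h (add_right_cancel (idx_injective π e))
    simp only [ValidContext, ne_eq, h, not_false_eq_true, true_and, if_false, add_zero]
    apply indicator_sum_of_ne <;> simp only [posR, posL] <;> omega

/-- Passing the right pointer `c` flips the parity precisely when `c ∈ S`. -/
theorem endpointParity_posR_succ (S : Finset (ZMod N)) (c : ZMod N) :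
    endpointParity π S (posR N π c + 1) =
      endpointParity π S (posR N π c) + if c ∈ S then 1 else 0 := by
  classical
  unfold endpointParity
  rw [← Finset.sum_ite_eq' S c (fun _ => (1 : ZMod 2)), ← Finset.sum_add_distrib]
  refine Finset.sum_congr rfl fun s _ => ?_
  have rs : posR N π s = 3 * idx N π s := rfl
  have ls : posL N π s = 3 * idx N π (s + 1) - 2 := rfl
  have rc : posR N π c = 3 * idx N π c := rfl
  have lc : posL N π c = 3 * idx N π (c + 1) - 2 := rfl
  have p2 : 1 ≤ idx N π (s + 1) := repr1_pos _
  by_cases h : s = c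
  · subst h
    simp only [if_true]
    split_ifs <;> first | decide | (exfalso; omega)
  · have h1 : idx N π s ≠ idx N π c := fun e => h (idx_injective π e)
    simp only [h, if_false]
    split_ifs <;> first | decide | (exfalso; omega)

theorem endpointParity_posL_succ (S : Finset (ZMod N)) (c : ZMod N) :
    endpointParity π S (posL N π c + 1) =
      endpointParity π S (posL N π c) + if c ∈ S then 1 else 0 := by
  classical
  unfold endpointParity
  rw [← Finset.sum_ite_eq' S c (fun _ => (1 : ZMod 2)), ← Finset.sum_add_distrib]
  refine Finset.sum_congr rfl fun s _ => ?_
  have rs : posR N π s = 3 * idx N π s := rfl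
  have ls : posL N π s = 3 * idx N π (s + 1) - 2 := rfl
  have rc : posR N π c = 3 * idx N π c := rfl
  have lc : posL N π c = 3 * idx N π (c + 1) - 2 := rfl
  have p1 : 1 ≤ idx N π (c + 1) := repr1_pos _
  have p2 : 1 ≤ idx N π (s + 1) := repr1_pos _
  by_cases h : s = c
  · subst h
    simp only [if_true]
    split_ifs <;> first | decide | (exfalso; omega)
  · have h2 : idx N π (s + 1) ≠ idx N π (c + 1) :=
      fun e => h (add_right_cancel (idx_injective π e))
    simp only [h, if_false]
    split_ifs <;> first | decide | (exfalso; omega)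

/-- There is no pointer at the middle coordinate of an entry. -/
theorem endpointParity_middle (S : Finset (ZMod N)) (i : ℕ) (hi : 1 ≤ i) :
    endpointParity π S (3 * i - 1) = endpointParity π S (3 * i) := by
  unfold endpointParity
  refine Finset.sum_congr rfl fun s _ => ?_
  have rs : posR N π s = 3 * idx N π s := rfl
  have ls : posL N π s = 3 * idx N π (s + 1) - 2 := rfl
  have p2 : 1 ≤ idx N π (s + 1) := repr1_pos _
  split_ifs <;> first | decide | (exfalso; omega)

/-- The word is cyclic: the parity is the same at its two ends. -/
theorem endpointParity_end (S : Finset (ZMod N)) :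
    endpointParity π S (3 * N + 1) = endpointParity π S 1 := by
  unfold endpointParity
  refine Finset.sum_congr rfl fun s _ => ?_
  have rs : posR N π s = 3 * idx N π s := rfl
  have ls : posL N π s = 3 * idx N π (s + 1) - 2 := rfl
  have p1 : 1 ≤ idx N π s := repr1_pos _
  have p2 : 1 ≤ idx N π (s + 1) := repr1_pos _
  have p3 : idx N π s ≤ N := repr1_le _
  have p4 : idx N π (s + 1) ≤ N := repr1_le _
  split_ifs <;> first | decide | (exfalso; omega)

/-- Every chord crosses an even number of chords. -/
theorem crossParity_univ [Fintype (ZMod N)] (c : ZMod N) : crossParity π Finset.univ c = 0 := by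
  have h := endpointParity_posR_add_posL π Finset.univ c
  have hshift (t : ℕ) : ∑ s, (if posL N π s < t then (1 : ZMod 2) else 0) =
      ∑ s, if 3 * idx N π s - 2 < t then 1 else 0 :=
    Equiv.sum_comp (Equiv.addRight (1 : ZMod N))
      fun s => if 3 * idx N π s - 2 < t then (1 : ZMod 2) else 0
  have hR : endpointParity π Finset.univ (posR N π c) = 1 := by
    unfold endpointParity
    rw [Finset.sum_add_distrib, hshift, ← Finset.sum_add_distrib]
    have rc : posR N π c = 3 * idx N π c := rfl
    calc _ = ∑ s, if s = c then (1 : ZMod 2) else 0 := by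
          refine Finset.sum_congr rfl fun s _ => ?_
          have p1 : 1 ≤ idx N π s := repr1_pos _
          have rs : posR N π s = 3 * idx N π s := rfl
          by_cases h : s = c
          · subst h
            simp only [if_true]
            split_ifs <;> first | decide | (exfalso; omega)
          · have h1 : idx N π s ≠ idx N π c := fun e => h (idx_injective π e)
            simp only [h, if_false]
            split_ifs <;> first | decide | (exfalso; omega)
      _ = 1 := by simp
  have hL : endpointParity π Finset.univ (posL N π c) = 0 := by
    unfold endpointParity
    rw [Finset.sum_add_distrib, hshift, ← Finset.sum_add_distrib]
    refine Finset.sum_eq_zero fun s _ => ?_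
    have p1 : 1 ≤ idx N π s := repr1_pos _
    have rs : posR N π s = 3 * idx N π s := rfl
    have p2 : 1 ≤ idx N π (c + 1) := repr1_pos _
    have lc : posL N π c = 3 * idx N π (c + 1) - 2 := rfl
    split_ifs <;> first | decide | (exfalso; omega)
  simpa [hR, hL] using h

/-- If the only functions invariant under the cycle permutation of `π` are the constants, then
no proper nonempty set of chords is crossed evenly by every chord. -/
theorem mem_iff_mem_of_crossParity_eq_zero
    (hcycle : ∀ g : ZMod N → ZMod 2, (∀ i, g (π (i - 1)) = g (π i - 1)) → ∀ x y, g x = g y)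
    (S : Finset (ZMod N)) (hS : ∀ c, crossParity π S c = 0) (x y : ZMod N) :
    x ∈ S ↔ y ∈ S := by
  have hRL (c : ZMod N) := endpointParity_posR_add_posL π S c
  simp only [hS, zero_add] at hRL
  have hzz (a : ZMod 2) : a + a = 0 := CharTwo.add_self_eq_zero a
  have hin (c : ZMod N) : endpointParity π S (posR N π (c + 1)) =
      endpointParity π S (posR N π c) := by
    have h1 := endpointParity_posL_succ π S c
    have p1 : 1 ≤ idx N π (c + 1) := repr1_pos _
    have h2 := endpointParity_middle π S (idx N π (c + 1)) p1
    have e : posL N π c + 1 = 3 * idx N π (c + 1) - 1 := by simp only [posL]; omega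
    rw [e, h2, ← hRL c] at h1
    rw [posR, h1]
    linear_combination hzz (endpointParity π S (posL N π c))
  have hinc (c : ZMod N) : endpointParity π S (posR N π c) =
      endpointParity π S (posR N π 0) := by
    have (k : ℕ) : endpointParity π S (posR N π (k : ZMod N)) =
        endpointParity π S (posR N π 0) := by
      induction k with
      | zero => simp
      | succ k ih => rw [Nat.cast_succ, hin, ih]
    simpa using this c.val
  have hout := hcycle (fun c => endpointParity π S (posL N π c)) (fun i => by
    have h1 := endpointParity_posR_succ π S (π (i - 1))
    rw [← hRL, ← add_assoc, hzz, zero_add] at h1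
    rw [← h1]
    have hi : posL N π (π i - 1) = 3 * repr1 N i - 2 := by simp [posL, idx]
    have hi' : posR N π (π (i - 1)) = 3 * repr1 N (i - 1) := by simp [posR, idx]
    rw [hi, hi']
    obtain h | h := (repr1_le (i - 1)).eq_or_lt
    · have hi0 : i = ((1 : ℕ) : ZMod N) := by
        have := repr1_cast (i - 1)
        rw [h] at this
        simp only [CharP.cast_eq_zero] at this
        rw [Nat.cast_one]
        exact (sub_eq_zero.1 this.symm)
      rw [h, hi0, repr1_natCast le_rfl (NeZero.pos N), endpointParity_end]
    · have : i = ((repr1 N (i - 1) + 1 : ℕ) : ZMod N) := by simp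
      conv_rhs => rw [this, repr1_natCast (by omega) h]
      congr 1) x y
  have hx := hRL x
  have hy := hRL y
  rw [hinc, hout] at hx
  rw [hinc] at hy
  rw [hx] at hy
  by_cases h1 : x ∈ S <;> by_cases h2 : y ∈ S <;> simp_all

end Chords

section Counting

variable {N : ℕ} (π : Equiv.Perm (ZMod N))

variable {π} in
theorem ValidContext.symm {p q : ZMod N} (h : ValidContext N π p q) : ValidContext N π q p :=
  ⟨h.1.symm, h.2.symm⟩

/-- The graph of pairs of distinct pointers that are not valid pointer contexts. -/
def parallelGraph : SimpleGraph (ZMod N) where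
  Adj p q := p ≠ q ∧ ¬ ValidContext N π p q
  symm := ⟨fun _ _ h => ⟨h.1.symm, fun h' => h.2 h'.symm⟩⟩
  loopless := ⟨fun _ h => h.1 rfl⟩

theorem parallelGraph_adj {p q : ZMod N} :
    (parallelGraph π).Adj p q ↔ p ≠ q ∧ ¬ ValidContext N π p q := Iff.rfl

open Classical in
/-- For an odd number of chords every chord is parallel to an even number of chords. -/
theorem even_degree_parallelGraph [NeZero N] [Fintype (ZMod N)] (hN : Odd N) (c : ZMod N) :
    Even ((parallelGraph π).degree c) := by
  have h := crossParity_univ π c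
  unfold crossParity at h
  rw [Finset.sum_boole, ZMod.natCast_eq_zero_iff_even] at h
  have hsplit : (Finset.univ.filter fun s => ValidContext N π s c).card +
      (parallelGraph π).degree c + 1 = N := by
    have hcard := Finset.card_univ (α := ZMod N)
    rw [Fintype.card_congr (Equiv.refl _), ZMod.card] at hcard
    rw [← SimpleGraph.card_neighborFinset_eq_degree, ← Finset.card_singleton c,
      ← Finset.card_union_of_disjoint, ← Finset.card_union_of_disjoint]
    · refine Eq.trans (congrArg Finset.card ?_) hcard
      ext s
      by_cases hs : s = c
      · simp [hs]
      · by_cases hv : ValidContext N π s c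
        · simp [hv]
        · have : c ≠ s ∧ ¬ ValidContext N π c s := ⟨Ne.symm hs, fun h' => hv h'.symm⟩
          simp [parallelGraph_adj, this.1, this.2]
    · rw [Finset.disjoint_left]
      intro a ha hac
      rw [Finset.mem_singleton] at hac
      subst hac
      obtain ha | ha := Finset.mem_union.1 ha
      · exact (Finset.mem_filter.1 ha).2.1 rfl
      · exact ((SimpleGraph.mem_neighborFinset _ _ _).1 ha).ne rfl
    · rw [Finset.disjoint_left]
      intro a ha hac
      simp only [Finset.mem_filter, Finset.mem_univ, true_and] at ha
      rw [SimpleGraph.mem_neighborFinset, parallelGraph_adj] at hac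
      exact hac.2 ha.symm
  by_contra hodd
  rw [Nat.not_even_iff_odd] at hodd
  have := (h.add_odd hodd).add_odd odd_one
  rw [hsplit] at this
  exact (Nat.not_even_iff_odd.2 hN) this

open Classical in
theorem numContexts_add_card_edges [Fintype (ZMod N)] :
    numContexts N π + (parallelGraph π).edgeFinset.card = N.choose 2 := by
  have hcompl : (parallelGraph π)ᶜ.edgeFinset.card + (parallelGraph π).edgeFinset.card =
      N.choose 2 := by
    rw [add_comm, ← Finset.card_union_of_disjoint, ← SimpleGraph.edgeFinset_sup]
    · have := SimpleGraph.card_edgeFinset_top_eq_card_choose_two (V := ZMod N)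
      rw [ZMod.card] at this
      rw [← this]
      congr!
      exact sup_compl_eq_top
    · exact SimpleGraph.disjoint_edgeFinset.2 disjoint_compl_right
  have hdart : {pq : ZMod N × ZMod N | ValidContext N π pq.1 pq.2}.ncard =
      2 * (parallelGraph π)ᶜ.edgeFinset.card := by
    rw [← SimpleGraph.dart_card_eq_twice_card_edges, ← Nat.card_eq_fintype_card,
      ← Nat.card_coe_set_eq]
    refine Nat.card_congr ⟨fun x => ⟨x.1, ?_⟩, fun d => ⟨d.toProd, ?_⟩, fun _ => rfl, fun _ => rfl⟩
    · exact (SimpleGraph.compl_adj _ _ _).2 ⟨x.2.1, fun h => h.2 x.2⟩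
    · have h := (SimpleGraph.compl_adj _ _ _).1 d.adj
      exact by_contra fun h' => h.2 ⟨h.1, h'⟩
  rw [numContexts, hdart, Nat.mul_div_cancel_left _ two_pos, hcompl]

end Counting

/-- In a graph with even degrees and one, two or three edges, there is an edge all of whose other
vertices see both of its ends or neither, and it has a common neighbour. -/
theorem SimpleGraph.exists_twins_of_even_degree {V : Type*} [Fintype V] [DecidableEq V]
    (G : SimpleGraph V) [DecidableRel G.Adj] (heven : ∀ v, Even (G.degree v))
    (h0 : 0 < G.edgeFinset.card) (h3 : G.edgeFinset.card ≤ 3) :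
    ∃ p q r, G.Adj p q ∧ r ≠ p ∧ r ≠ q ∧ ∀ c, c ≠ p → c ≠ q → (G.Adj p c ↔ G.Adj q c) := by
  have htwo (v w : V) (h : G.Adj v w) : 2 ≤ G.degree v := by
    have h1 : 0 < G.degree v := (G.degree_pos_iff_exists_adj v).2 ⟨w, h⟩
    obtain ⟨k, hk⟩ := heven v
    omega
  have hother (v w : V) (h : G.Adj v w) : ∃ u, u ≠ w ∧ G.Adj v u := by
    have h2 := htwo v w h
    rw [← SimpleGraph.card_neighborFinset_eq_degree] at h2
    obtain ⟨u, hu, huw⟩ := Finset.exists_mem_ne h2 w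
    exact ⟨u, huw, by simpa using hu⟩
  have hfour (a b c d : V) (hab : G.Adj a b) (hcd : G.Adj c d) (hac : a ≠ c) (had : a ≠ d)
      (hbc : b ≠ c) (hbd : b ≠ d) : False := by
    have hsum := G.sum_degrees_eq_twice_card_edges
    have hle : ∑ v ∈ ({a, b, c, d} : Finset V), G.degree v ≤ ∑ v, G.degree v :=
      Finset.sum_le_sum_of_subset (Finset.subset_univ _)
    rw [Finset.sum_insert (by simp [hab.ne, hac, had]), Finset.sum_insert (by simp [hbc, hbd]),
      Finset.sum_insert (by simp [hcd.ne]), Finset.sum_singleton] at hle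
    have := htwo _ _ hab
    have := htwo _ _ hab.symm
    have := htwo _ _ hcd
    have := htwo _ _ hcd.symm
    omega
  obtain ⟨e, he⟩ := Finset.card_pos.1 h0
  induction e with
  | _ p q =>
    have hpq : G.Adj p q := by simpa using he
    obtain ⟨r, hrq, hpr⟩ := hother p q hpq
    have key (p q c : V) (hpq : G.Adj p q) (hcp : c ≠ p) (hcq : c ≠ q) (h : G.Adj p c) :
        G.Adj q c := by
      obtain ⟨d, hdp, hqd⟩ := hother q p hpq.symm
      by_cases hdc : d = c
      · rwa [← hdc]
      · exact (hfour p c q d h hqd hpq.ne hdp.symm hcq (Ne.symm hdc)).elim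
    exact ⟨p, q, r, hpq, hpr.ne', hrq, fun c hcp hcq =>
      ⟨key p q c hpq hcp hcq, key q p c hpq.symm hcq hcp⟩⟩

/-- If the only functions invariant under the cycle permutation of `π` are the constants, then
the number of pairs of parallel chords is not one, two or three. -/
theorem three_lt_of_numContexts_add_eq_choose {N : ℕ} [NeZero N] (π : Equiv.Perm (ZMod N)) (hN : Odd N)
    (hcycle : ∀ g : ZMod N → ZMod 2, (∀ i, g (π (i - 1)) = g (π i - 1)) → ∀ x y, g x = g y)
    {c : ℕ} (hc : numContexts N π + c = N.choose 2) (h0 : 0 < c) : 3 < c := by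
  classical
  have hedge := numContexts_add_card_edges π
  obtain rfl : (parallelGraph π).edgeFinset.card = c := by omega
  by_contra! h3
  obtain ⟨p, q, r, hpq, hrp, hrq, htwin⟩ :=
    (parallelGraph π).exists_twins_of_even_degree (even_degree_parallelGraph π hN) h0 h3
  have hS (c : ZMod N) : crossParity π {p, q} c = 0 := by
    rw [crossParity, Finset.sum_pair hpq.ne]
    by_cases hcp : c = p
    · subst hcp
      rw [if_neg fun h => h.1 rfl, if_neg hpq.symm.2, add_zero]
    by_cases hcq : c = q
    · subst hcq
      rw [if_neg hpq.2, if_neg fun h => h.1 rfl, add_zero]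
    have h := htwin c hcp hcq
    have : ValidContext N π p c ↔ ValidContext N π q c := by
      simpa [parallelGraph_adj, Ne.symm hcp, Ne.symm hcq, not_iff_not] using h
    rw [if_congr this rfl rfl]
    exact CharTwo.add_self_eq_zero _
  have := mem_iff_mem_of_crossParity_eq_zero π hcycle {p, q} hS p r
  simp [hrp, hrq] at this

section Listing

theorem listFun_zero {N : ℕ} (π : Equiv.Perm (ZMod N)) : listFun N π 0 = 0 := if_pos rfl

variable {N : ℕ} [NeZero N] (π : Equiv.Perm (ZMod N))

theorem emb_val (x : ZMod N) : (emb N x).val = repr1 N x :=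
  ZMod.val_natCast_of_lt (Nat.lt_succ_of_le (repr1_le x))

theorem listFun_val_of_ne_zero {i : ZMod (N + 1)} (hi : i ≠ 0) :
    (listFun N π i).val = repr1 N (π (i.val : ZMod N)) := by
  rw [listFun, if_neg hi, emb_val]

theorem listFun_ne_zero {i : ZMod (N + 1)} (hi : i ≠ 0) : listFun N π i ≠ 0 := by
  rw [← ZMod.val_ne_zero, listFun_val_of_ne_zero π hi]
  exact Nat.one_le_iff_ne_zero.1 (repr1_pos _)

theorem listInv_listFun (i : ZMod (N + 1)) : listInv N π (listFun N π i) = i := by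
  by_cases hi : i = 0
  · simp [hi, listFun, listInv]
  · rw [listInv, if_neg (listFun_ne_zero π hi), listFun_val_of_ne_zero π hi, repr1_cast,
      Equiv.symm_apply_apply, emb, repr1_natCast, ZMod.natCast_zmod_val]
    · exact Nat.one_le_iff_ne_zero.2 ((ZMod.val_ne_zero i).2 hi)
    · exact Nat.le_of_lt_succ (ZMod.val_lt i)

theorem listFun_listInv (y : ZMod (N + 1)) : listFun N π (listInv N π y) = y :=
  listInv_listFun π.symm y

theorem Yfun_listFun (i : ZMod (N + 1)) : Yfun N π (listFun N π i) = listFun N π (i - 1) := by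
  rw [Yfun, listInv_listFun]

theorem Cfun_listFun_sub_one (i : ZMod (N + 1)) :
    Cfun N π (listFun N π i - 1) = listFun N π (i - 1) := by
  rw [Cfun, sub_add_cancel, Yfun_listFun]

theorem Cfun_surjective : Function.Surjective (Cfun N π) := fun z =>
  ⟨listFun N π (listInv N π z + 1) - 1, by
    rw [Cfun_listFun_sub_one, add_sub_cancel_right, listFun_listInv]⟩

end Listing

/-- If every point other than `a` and `b` lies on the orbit of `a` before the first visit to `b`,
then the orbit of `a` is everything and `b` is mapped to `a`. -/
theorem orbit_eq_univ_of_ncard {α : Type*} [Fintype α] (f : α → α) (hf : Function.Surjective f)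
    {a b : α} (hab : a ≠ b) (hcard : 2 < Fintype.card α)
    (h : {x | ∃ k m : ℕ, 0 < k ∧ k < m ∧ f^[m] a = b ∧ (∀ j, 0 < j → j < m → f^[j] a ≠ b) ∧
      f^[k] a = x}.ncard = Fintype.card α - 2) :
    (∀ x, ∃ k, f^[k] a = x) ∧ f b = a := by
  classical
  set P := {x | ∃ k m : ℕ, 0 < k ∧ k < m ∧ f^[m] a = b ∧ (∀ j, 0 < j → j < m → f^[j] a ≠ b) ∧
      f^[k] a = x}
  have hsub : P ⊆ ({a, b} : Set α)ᶜ := by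
    rintro x ⟨k, m, hk, hkm, hm, hj, rfl⟩ hx
    obtain hx | hx := hx
    · refine hj (m - k) (by omega) (by omega) ?_
      rw [← hm]
      conv_rhs => rw [← Nat.sub_add_cancel hkm.le, Function.iterate_add_apply, hx]
    · exact hj k hk hkm hx
  have hPc : P = ({a, b} : Set α)ᶜ := by
    refine Set.eq_of_subset_of_ncard_le hsub ?_
    rw [h, Set.ncard_compl, Set.ncard_pair hab, Nat.card_eq_fintype_card]
  have hne : P.Nonempty := by
    rw [← Set.ncard_pos, h]
    omega
  obtain ⟨-, k, m, hk, hkm, hm, hj, -⟩ := hne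
  have horb (x : α) (hxa : x ≠ a) (hxb : x ≠ b) : ∃ k, 0 < k ∧ k < m ∧ f^[k] a = x := by
    have : x ∈ P := by
      rw [hPc]
      rintro (h | h)
      exacts [hxa h, hxb h]
    obtain ⟨k, m', hk, hkm, hm', hj', hx⟩ := this
    refine ⟨k, hk, ?_, hx⟩
    obtain hlt | rfl | hlt := lt_trichotomy m m'
    · exact (hj' m (by omega) hlt hm).elim
    · exact hkm
    · exact (hj m' (by omega) hlt hm').elim
  refine ⟨fun x => ?_, ?_⟩
  · by_cases hxa : x = a
    · exact ⟨0, hxa.symm⟩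
    · by_cases hxb : x = b
      · exact ⟨m, hxb ▸ hm⟩
      · obtain ⟨k, -, -, h⟩ := horb x hxa hxb
        exact ⟨k, h⟩
  · obtain ⟨y, hy⟩ := hf a
    have hreturn (k : ℕ) (hkm : k < m) : f^[k + 1] a ≠ a := fun h => by
      by_cases hk : k + 1 = m
      · exact hab (by rw [← h, hk, hm])
      · refine hj (m - (k + 1)) (by omega) (by omega) ?_
        rw [← hm]
        conv_rhs => rw [← Nat.sub_add_cancel (show k + 1 ≤ m by omega),
          Function.iterate_add_apply, h]
    by_cases hya : y = a
    · exact (hreturn 0 (by omega) (by rw [← hya] at hy ⊢; exact hy)).elim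
    · by_cases hyb : y = b
      · rwa [← hyb]
      · obtain ⟨k, -, hkm, rfl⟩ := horb y hya hyb
        exact (hreturn k hkm (by rw [Function.iterate_succ_apply', hy])).elim

theorem MaxPile.orbit {N : ℕ} [NeZero N] {π : Equiv.Perm (ZMod N)} (hN : Even N)
    (h : MaxPile N π) :
    (∀ x, ∃ k, (Cfun N π)^[k] (N : ZMod (N + 1)) = x) ∧ Cfun N π 0 = (N : ZMod (N + 1)) := by
  have hpos := NeZero.pos N
  obtain ⟨-, h⟩ | ⟨hodd, -⟩ := h
  · refine orbit_eq_univ_of_ncard _ (Cfun_surjective π) ?_ ?_ ?_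
    · rw [← ZMod.val_ne_zero, ZMod.val_natCast_of_lt N.lt_succ_self]
      exact hpos.ne'
    · rw [ZMod.card]
      obtain ⟨k, hk⟩ := hN
      omega
    · rw [ZMod.card]
      exact h
  · exact (Nat.not_even_iff_odd.2 hodd hN).elim

/-- The contraction of a permutation with maximal strategic pile has a transitive cycle
permutation. -/
theorem eq_of_invariant_of_isContraction {N : ℕ} [NeZero N] {α : Type*}
    {π : Equiv.Perm (ZMod (N + 1))} {ρ : Equiv.Perm (ZMod N)} {m : ℕ} (hN : Odd N)
    (hπ : MaxPile (N + 1) π) (h1m : 1 ≤ m) (hmN : m ≤ N + 1)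
    (hm : π (m : ZMod (N + 1)) = 0)
    (hlt : ∀ k : ℕ, 1 ≤ k → k < m →
      ρ (k : ZMod N) = ((repr1 (N + 1) (π (k : ZMod (N + 1))) : ℕ) : ZMod N))
    (hge : ∀ k : ℕ, m ≤ k → k ≤ N →
      ρ (k : ZMod N) = ((repr1 (N + 1) (π ((k + 1 : ℕ) : ZMod (N + 1))) : ℕ) : ZMod N))
    (g : ZMod N → α) (hg : ∀ i, g (ρ (i - 1)) = g (ρ i - 1)) (x y : ZMod N) : g x = g y := by
  obtain ⟨horb, hzero⟩ := hπ.orbit hN.add_one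
  have hNpos := NeZero.pos N
  set L : ℕ → ℕ := fun k => if k = 0 then 0 else repr1 (N + 1) (π (k : ZMod (N + 1)))
  have hL0 : L 0 = 0 := rfl
  have hLk {k : ℕ} (hk : 1 ≤ k) : L k = repr1 (N + 1) (π (k : ZMod (N + 1))) :=
    if_neg (by omega)
  have hLle (k : ℕ) : L k ≤ N + 1 := by
    by_cases hk : k = 0
    · simp [hk, hL0]
    · rw [hLk (by omega)]
      exact repr1_le _
  have hLpos {k : ℕ} (hk : 1 ≤ k) : 1 ≤ L k := by
    rw [hLk hk]
    exact repr1_pos _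
  have hLlist (k : ℕ) (hk : k ≤ N + 1) :
      listFun (N + 1) π (k : ZMod (N + 1 + 1)) = (L k : ZMod (N + 1 + 1)) := by
    by_cases h0 : k = 0
    · simp [h0, hL0, listFun_zero]
    · have hv : (k : ZMod (N + 1 + 1)).val = k := ZMod.val_natCast_of_lt (by omega)
      rw [hLk (by omega), listFun, if_neg fun h => h0 (by rw [← hv, h, ZMod.val_zero]), hv, emb]
  have hLinj {j k : ℕ} (hj : j ≤ N + 1) (hk : k ≤ N + 1) (h : L j = L k) : j = k := by
    have h' : (j : ZMod (N + 1 + 1)) = k := by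
      rw [← listInv_listFun π j, ← listInv_listFun π k, hLlist j hj, hLlist k hk, h]
    rw [← ZMod.val_natCast_of_lt (show j < N + 1 + 1 by omega), h',
      ZMod.val_natCast_of_lt (by omega)]
  have hLm : L m = N + 1 := by simp [hLk h1m, hm, repr1]
  have hLne {k : ℕ} (hk : k ≤ N + 1) (hkm : k ≠ m) : L k ≤ N := by
    have := hLle k
    have : L k ≠ N + 1 := fun h => hkm (hLinj hk hmN (h.trans hLm.symm))
    omega
  -- the entry `1` follows the entry `N + 1`
  have hnext : m ≤ N ∧ L (m + 1) = 1 := by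
    have hval1 : (1 : ZMod (N + 1 + 1)).val = 1 :=
      (congrArg ZMod.val Nat.cast_one.symm).trans (ZMod.val_natCast_of_lt (by omega))
    set j := listInv (N + 1) π 1
    have hj1 : listFun (N + 1) π j = 1 := listFun_listInv π 1
    have hC := Cfun_listFun_sub_one π j
    rw [hj1, sub_self, hzero] at hC
    have hjm : j = (m : ZMod (N + 1 + 1)) + 1 := by
      have hNm : ((N + 1 : ℕ) : ZMod (N + 1 + 1)) = (L m : ZMod (N + 1 + 1)) := by rw [hLm]
      rw [← sub_eq_iff_eq_add, ← listInv_listFun π (j - 1), ← hC, hNm, ← hLlist m hmN,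
        listInv_listFun]
    by_cases hmN' : m ≤ N
    · refine ⟨hmN', ?_⟩
      rw [hjm, ← Nat.cast_succ, hLlist _ (by omega)] at hj1
      have := congrArg ZMod.val hj1
      rwa [ZMod.val_natCast_of_lt (Nat.lt_succ_of_le (hLle _)), hval1] at this
    · obtain rfl : m = N + 1 := by omega
      rw [hjm, ← Nat.cast_succ, ZMod.natCast_self, listFun_zero] at hj1
      have := congrArg ZMod.val hj1
      rw [ZMod.val_zero, hval1] at this
      omega
  obtain ⟨hmN', hLm1⟩ := hnext
  have hρlt (k : ℕ) (hk : 1 ≤ k) (hkm : k < m) : ρ (k : ZMod N) = (L k : ZMod N) := by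
    rw [hLk hk, hlt k hk hkm]
  have hρge (k : ℕ) (hk : m ≤ k) (hkN : k ≤ N) : ρ (k : ZMod N) = (L (k + 1) : ZMod N) := by
    rw [hLk (by omega), hge k hk hkN]
  have hρ0 : ρ 0 = (L (N + 1) : ZMod N) := by
    rw [← hρge N hmN' le_rfl, ZMod.natCast_self]
  have hg' (k : ℕ) : g (ρ (k : ZMod N)) = g (ρ ((k + 1 : ℕ) : ZMod N) - 1) := by
    rw [← hg, Nat.cast_succ, add_sub_cancel_right]
  set γ : ℕ → α := fun v => if v = 0 ∨ v = N + 1 then g (ρ 0) else g (v : ZMod N)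
  have hγ0 : γ 0 = g (ρ 0) := if_pos (Or.inl rfl)
  have hγN : γ (N + 1) = g (ρ 0) := if_pos (Or.inr rfl)
  have hγv {v : ℕ} (h1 : 1 ≤ v) (h2 : v ≤ N) : γ v = g (v : ZMod N) := if_neg (by omega)
  have hγL {k : ℕ} (hk : 1 ≤ k) (hkN : k ≤ N + 1) (hkm : k ≠ m) : γ (L k) = g (L k : ZMod N) :=
    hγv (hLpos hk) (hLne hkN hkm)
  have hγpred {v : ℕ} (h1 : 2 ≤ v) (h2 : v ≤ N + 1) : γ (v - 1) = g ((v : ZMod N) - 1) := by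
    rw [hγv (by omega) (by omega), Nat.cast_sub (by omega), Nat.cast_one]
  have hstep (k : ℕ) (hk : k < N + 1) : γ (L k) = γ (L (k + 1) - 1) := by
    obtain hkm | hkm | hkm := lt_trichotomy k m
    · have hL2 : 2 ≤ L (k + 1) := by
        have := hLpos (show 1 ≤ k + 1 by omega)
        have : L (k + 1) ≠ 1 := fun h => by
          have := hLinj (by omega) (by omega) (h.trans hLm1.symm)
          omega
        omega
      have hleft : γ (L k) = g (ρ (k : ZMod N)) := by
        by_cases hk0 : k = 0
        · rw [hk0, hL0, hγ0, Nat.cast_zero]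
        · rw [hγL (by omega) (by omega) hkm.ne, hρlt k (by omega) hkm]
      rw [hleft, hγpred hL2 (hLle _), hg']
      by_cases hk1 : k + 1 = m
      · rw [hk1, hρge m le_rfl hmN', hLm, hLm1]
        simp
      · rw [hρlt (k + 1) (by omega) (by omega)]
    · rw [hkm, hLm, hLm1, hγN, Nat.sub_self, hγ0]
    · have hL2 : 2 ≤ L (k + 1) := by
        have := hLpos (show 1 ≤ k + 1 by omega)
        have : L (k + 1) ≠ 1 := fun h => by
          have := hLinj (by omega) (by omega) (h.trans hLm1.symm)
          omega
        omega
      obtain ⟨k, rfl⟩ : ∃ j, k = j + 1 := ⟨k - 1, by omega⟩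
      rw [hγL (by omega) (by omega) (by omega), hγpred hL2 (hLle _),
        ← hρge k (by omega) (by omega), ← hρge (k + 1) (by omega) (by omega), hg']
  have hlast : γ (L (N + 1)) = γ (N + 1) := by
    rw [hγL (by omega) le_rfl (by omega), hγN, hρ0]
  -- hence `γ` is constant on the orbits of the cycle permutation of `π`
  have hC (z : ZMod (N + 1 + 1)) : γ (Cfun (N + 1) π z).val = γ z.val := by
    obtain ⟨i, rfl⟩ : ∃ i, z = listFun (N + 1) π i - 1 :=
      ⟨listInv (N + 1) π (z + 1), by rw [listFun_listInv, add_sub_cancel_right]⟩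
    have hval {v : ℕ} (hv : v ≤ N + 1) : (v : ZMod (N + 1 + 1)).val = v :=
      ZMod.val_natCast_of_lt (by omega)
    have hneg : (-1 : ZMod (N + 1 + 1)) = ((N + 1 : ℕ) : ZMod (N + 1 + 1)) :=
      neg_eq_of_add_eq_zero_left (by rw [← Nat.cast_succ, ZMod.natCast_self])
    rw [Cfun_listFun_sub_one]
    obtain ⟨k, hk, rfl⟩ : ∃ k : ℕ, k ≤ N + 1 ∧ i = (k : ZMod (N + 1 + 1)) :=
      ⟨i.val, Nat.le_of_lt_succ (ZMod.val_lt i), (ZMod.natCast_zmod_val i).symm⟩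
    obtain rfl | ⟨k, rfl⟩ : k = 0 ∨ ∃ j, k = j + 1 := by cases k <;> simp
    · rw [Nat.cast_zero, listFun_zero, zero_sub, hneg, hLlist _ le_rfl, hval (hLle _), hval le_rfl,
        hlast]
    · rw [hLlist _ hk, Nat.cast_succ, add_sub_cancel_right, hLlist k (by omega), hval (hLle _),
        hstep k (by omega)]
      have h1 := hLpos (show 1 ≤ k + 1 by omega)
      have h2 := hLle (k + 1)
      have hsub : (L (k + 1) : ZMod (N + 1 + 1)) - 1 = ((L (k + 1) - 1 : ℕ) : ZMod (N + 1 + 1)) := by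
        rw [Nat.cast_sub h1, Nat.cast_one]
      rw [hsub, hval (by omega)]
  have hCk (k : ℕ) : γ ((Cfun (N + 1) π)^[k] ((N + 1 : ℕ) : ZMod (N + 1 + 1))).val =
      γ ((N + 1 : ℕ) : ZMod (N + 1 + 1)).val := by
    induction k with
    | zero => rfl
    | succ k ih => rw [Function.iterate_succ_apply', hC, ih]
  have hconst (z : ZMod N) : g z = γ ((N + 1 : ℕ) : ZMod (N + 1 + 1)).val := by
    obtain ⟨k, hk⟩ := horb ((repr1 N z : ℕ) : ZMod (N + 1 + 1))
    have h1 := repr1_pos z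
    have h2 := repr1_le z
    rw [← hCk k, hk, ZMod.val_natCast_of_lt (by omega), hγv h1 h2, repr1_cast]
  rw [hconst x, hconst y]

/-- Let `π ∈ M_{2n}` have exactly `C(2n-1,2) - c` valid pointer contexts
with `c > 0`.  Then `c ∉ {1, 2, 3}`. -/
theorem stmt18 (n c : ℕ) (hn : 0 < n) (π : Equiv.Perm (ZMod (2 * n - 1)))
    (hπ : π ∈ MsetAll n) (hc : 0 < c) (hcle : c ≤ Nat.choose (2 * n - 1) 2)
    (hnum : numContexts (2 * n - 1) π = Nat.choose (2 * n - 1) 2 - c) :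
    c ≠ 1 ∧ c ≠ 2 ∧ c ≠ 3 := by
  obtain ⟨σ, hσ, m, h1m, hm, hm0, hlt, hge⟩ := hπ
  obtain ⟨N, hN⟩ : ∃ N, N = 2 * n - 1 := ⟨_, rfl⟩
  have h2n : 2 * n = N + 1 := by omega
  have hodd : Odd N := ⟨n - 1, by omega⟩
  have : NeZero N := ⟨by omega⟩
  clear hN
  revert π σ
  rw [h2n, Nat.add_sub_cancel]
  intro π hnum σ hσ hm0 hlt hge
  rw [h2n] at hm
  rw [h2n, Nat.add_sub_cancel] at hcle
  rw [ZMod.natCast_self] at hm0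
  have := three_lt_of_numContexts_add_eq_choose π hodd
    (eq_of_invariant_of_isContraction hodd hσ h1m hm hm0 hlt hge) (c := c) (by omega) hc
  omega
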